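/- For τ in the upper half-plane, G̃_{2,2}(τ) = G₄(τ) + (2π²/(3τ²)) G₂(τ) − 2π⁴/(15τ⁴), where G̃_{2,2}(τ) is taken with the conditionally convergent iterated order of summation (inner sums over n₂ then n₁, outer over m). -/

import Mathlib

open Real

/-- The Eisenstein series `G_k(τ)` (iterated summation, inner over `n`). -/
noncomputable def G (k : ℕ) (τ : ℂ) : ℂ :=
  ∑' m : ℤ, ∑' n : ℤ, if m = 0 ∧ n = 0 then 0 else 1 / ((m : ℂ) + n * τ) ^ k

/-- The double Eisenstein-type series `G̃_{2p,2q}(τ)` in the iterated order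
of summation (inner over `n₂`, then `n₁`, outer over `m`). -/
noncomputable def tildeG (p q : ℕ) (τ : ℂ) : ℂ :=
  ∑' m : ℤ, ∑' n₁ : ℤ, ∑' n₂ : ℤ,
    if (m = 0 ∧ n₁ = 0) ∨ (m = 0 ∧ n₂ = 0) then 0
    else 1 / (((m : ℂ) + n₁ * τ) ^ (2 * p) * ((m : ℂ) + n₂ * τ) ^ (2 * q))

lemma cube_geom (q : ℂ) (hq : ‖q‖ < 1) :
    ∑' n : ℕ, (n : ℂ) ^ 3 * q ^ n = q * (1 + 4 * q + q ^ 2) / (1 - q) ^ 4 := by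
  have h3 := hasSum_choose_mul_geometric_of_norm_lt_one 3 hq
  have h2 := hasSum_choose_mul_geometric_of_norm_lt_one 2 hq
  have h1 := hasSum_choose_mul_geometric_of_norm_lt_one 1 hq
  have h0 := hasSum_choose_mul_geometric_of_norm_lt_one 0 hq
  have h := (((h3.mul_left 6).sub (h2.mul_left 12)).add (h1.mul_left 7)).sub h0
  have hne : 1 - q ≠ 0 := by
    intro h
    have : q = 1 := (sub_eq_zero.mp h).symm
    simp [this] at hq
  have c2 : ∀ n : ℕ, 2 * ((n + 2).choose 2 : ℂ) = (n + 2) * (n + 1) := by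
    intro n
    induction n with
    | zero => norm_num
    | succ n ih =>
      rw [show n + 1 + 2 = (n + 2) + 1 by ring, Nat.choose_succ_succ' (n + 2) 1]
      push_cast
      rw [mul_add, ih]
      simp
      ring
  have c3 : ∀ n : ℕ, 6 * ((n + 3).choose 3 : ℂ) = (n + 3) * (n + 2) * (n + 1) := by
    intro n
    induction n with
    | zero => norm_num
    | succ n ih =>
      rw [show n + 1 + 3 = (n + 3) + 1 by ring, Nat.choose_succ_succ' (n + 3) 2]
      have := c2 (n + 1)
      rw [show n + 1 + 2 = n + 3 by ring] at this
      push_cast at this ⊢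
      linear_combination ih + 3 * this
  have e : ∀ n : ℕ, (n : ℂ) ^ 3 * q ^ n = 6 * (((n + 3).choose 3 : ℂ) * q ^ n)
      - 12 * (((n + 2).choose 2 : ℂ) * q ^ n) + 7 * (((n + 1).choose 1 : ℂ) * q ^ n)
      - ((n + 0).choose 0 : ℂ) * q ^ n := by
    intro n
    have h2 := c2 n
    have h3 := c3 n
    simp only [Nat.choose_one_right, add_zero, Nat.choose_zero_right]
    push_cast
    linear_combination (-h3 + 6 * h2) * q ^ n
  rw [tsum_congr e, h.tsum_eq]
  field_simp
  ring

/-- The sum over integers, in closed form. -/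
lemma F_two (z : ℂ) (hz : 0 < z.im) :
    ∑' n : ℤ, 1 / (z + n) ^ 2 = -4 * (π : ℂ) ^ 2 *
      (Complex.exp (2 * π * Complex.I * z) / (1 - Complex.exp (2 * π * Complex.I * z)) ^ 2) := by
  have h := EisensteinSeries.qExpansion_identity (k := 1) le_rfl ⟨z, hz⟩
  have hq := UpperHalfPlane.norm_exp_two_pi_I_lt_one ⟨z, hz⟩
  simp only [pow_one] at h
  rw [tsum_coe_mul_geometric_of_norm_lt_one hq] at h
  simp only [Nat.reduceAdd] at h
  rw [h]
  simp only [mul_pow, Complex.I_sq, Nat.factorial]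
  norm_num

lemma F_four (z : ℂ) (hz : 0 < z.im) :
    ∑' n : ℤ, 1 / (z + n) ^ 4 =
      (∑' n : ℤ, 1 / (z + n) ^ 2) ^ 2 - 2 * (π : ℂ) ^ 2 / 3 * ∑' n : ℤ, 1 / (z + n) ^ 2 := by
  have h := EisensteinSeries.qExpansion_identity (k := 3) (by norm_num) ⟨z, hz⟩
  have hq := UpperHalfPlane.norm_exp_two_pi_I_lt_one ⟨z, hz⟩
  rw [cube_geom _ hq] at h
  rw [F_two z hz]
  simp only [Nat.reduceAdd] at h hq
  rw [h]
  set q := Complex.exp (2 * π * Complex.I * z)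
  have hne : 1 - q ≠ 0 := by
    intro h
    have : q = 1 := (sub_eq_zero.mp h).symm
    simp [this] at hq
  simp only [mul_pow, Complex.I_pow_four, Nat.factorial]
  push_cast
  field_simp
  ring

lemma S_eq (k : ℕ) (hk : Even k) (τ : ℂ) (hτ : 0 < τ.im) (m : ℤ) :
    ∑' n : ℤ, 1 / ((m : ℂ) + n * τ) ^ k =
      (1 / τ ^ k) * ∑' n : ℤ, 1 / ((m.natAbs : ℂ) * (-1 / τ) + n) ^ k := by
  have h0 : τ ≠ 0 := by rintro rfl; simp at hτ
  rw [← tsum_mul_left]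
  rcases le_total 0 m with hm | hm
  · have hc : ((m.natAbs : ℤ) : ℂ) = m := by rw [Int.natAbs_of_nonneg hm]
    rw [Int.cast_natCast] at hc
    rw [hc, ← (Equiv.neg ℤ).tsum_eq]
    refine tsum_congr fun n => ?_
    rw [one_div_mul_one_div, ← mul_pow, ← hk.neg_pow]
    congr 2
    simp
    field_simp
    ring
  · have hc : ((m.natAbs : ℤ) : ℂ) = -m := by rw [Int.ofNat_natAbs_of_nonpos hm]; simp
    rw [Int.cast_natCast] at hc
    rw [hc]
    refine tsum_congr fun n => ?_
    rw [one_div_mul_one_div, ← mul_pow]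
    congr 2
    field_simp

lemma S_zero (k : ℕ) (hk : Even k) (hk0 : k ≠ 0) (τ : ℂ) (hτ : 0 < τ.im) :
    ∑' n : ℤ, 1 / (((0 : ℤ) : ℂ) + n * τ) ^ k = (1 / τ ^ k) * (2 * riemannZeta k) := by
  rw [S_eq k hk τ hτ, two_mul_riemannZeta_eq_tsum_int_inv_pow_of_even]
  · simp
  · have := hk.two_dvd; exact Nat.le_of_dvd (by omega) this
  · exact hk

lemma S_summable (τ : ℂ) (hτ : 0 < τ.im) :
    Summable fun m : ℤ => ∑' n : ℤ, 1 / ((m : ℂ) + n * τ) ^ 2 := by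
  have h0 : τ ≠ 0 := by rintro rfl; simp at hτ
  have him : 0 < (-1 / τ).im := by
    rw [neg_div, one_div, Complex.neg_im, Complex.inv_im, neg_div, neg_neg]
    exact div_pos hτ (Complex.normSq_pos.mpr h0)
  set w := -1 / τ with hw
  have hr := UpperHalfPlane.norm_exp_two_pi_I_lt_one ⟨w, him⟩
  simp only at hr
  set q := Complex.exp (2 * π * Complex.I * w) with hqd
  have hs : Summable fun a : ℕ => (1 / τ ^ 2) * ∑' n : ℤ, 1 / ((a : ℂ) * w + n) ^ 2 := by
    refine Summable.mul_left _ ?_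
    rw [← summable_nat_add_iff 1]
    have hg : Summable fun a : ℕ => (4 * π ^ 2 / (1 - ‖q‖) ^ 2) * ‖q‖ ^ (a + 1) :=
      ((summable_nat_add_iff 1).mpr (summable_geometric_of_lt_one (norm_nonneg _) hr)).mul_left _
    refine Summable.of_norm_bounded hg fun a => ?_
    have hz : 0 < (((a + 1 : ℕ) : ℂ) * w).im := by
      rw [← Complex.ofReal_natCast, Complex.im_ofReal_mul]
      positivity
    rw [F_two _ hz]
    have hq : Complex.exp (2 * π * Complex.I * (((a + 1 : ℕ) : ℂ) * w)) = q ^ (a + 1) := by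
      rw [hqd, ← Complex.exp_nat_mul]; congr 1; ring
    rw [hq]
    have h1 : 1 - ‖q‖ ≤ ‖1 - q ^ (a + 1)‖ := by
      have := norm_sub_norm_le (1 : ℂ) (q ^ (a + 1))
      rw [norm_one, norm_pow] at this
      have h2 : ‖q‖ ^ (a + 1) ≤ ‖q‖ := pow_le_of_le_one (norm_nonneg _) hr.le (by omega)
      linarith
    have h3 : 0 < 1 - ‖q‖ := by linarith
    simp only [norm_mul, norm_div, norm_pow, norm_neg, Complex.norm_real, Real.norm_eq_abs,
      abs_of_pos Real.pi_pos, RCLike.norm_ofNat]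
    rw [mul_div_assoc', div_mul_eq_mul_div]
    gcongr
  refine (Summable.congr ?_ fun m => (S_eq 2 even_two τ hτ m).symm)
  refine Summable.of_nat_of_neg ?_ ?_
  · simpa using hs
  · simpa using hs

lemma S_four (τ : ℂ) (hτ : 0 < τ.im) (m : ℤ) :
    ∑' n : ℤ, 1 / ((m : ℂ) + n * τ) ^ 4 =
      (∑' n : ℤ, 1 / ((m : ℂ) + n * τ) ^ 2) ^ 2
      - 2 * (π : ℂ) ^ 2 / (3 * τ ^ 2) * ∑' n : ℤ, 1 / ((m : ℂ) + n * τ) ^ 2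
      + if m = 0 then 2 * (π : ℂ) ^ 4 / (15 * τ ^ 4) else 0 := by
  have h0 : τ ≠ 0 := by rintro rfl; simp at hτ
  split_ifs with hm
  · subst hm
    rw [S_zero 4 (by decide) (by norm_num) τ hτ, S_zero 2 (by decide) (by norm_num) τ hτ]
    push_cast
    rw [riemannZeta_two, riemannZeta_four]
    field_simp
    ring
  · have him : 0 < (-1 / τ).im := by
      rw [neg_div, one_div, Complex.neg_im, Complex.inv_im, neg_div, neg_neg]
      exact div_pos hτ (Complex.normSq_pos.mpr h0)
    have hz : 0 < ((m.natAbs : ℂ) * (-1 / τ)).im := by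
      rw [← Complex.ofReal_natCast, Complex.im_ofReal_mul]
      have : 0 < m.natAbs := Int.natAbs_pos.mpr hm
      positivity
    rw [S_eq 4 (by decide) τ hτ, S_eq 2 (by decide) τ hτ, F_four _ hz]
    field_simp
    ring

lemma G_eq (k : ℕ) (hk : k ≠ 0) (τ : ℂ) :
    G k τ = ∑' m : ℤ, ∑' n : ℤ, 1 / ((m : ℂ) + n * τ) ^ k := by
  unfold G
  refine tsum_congr fun m => tsum_congr fun n => ?_
  split_ifs with h
  · simp [h.1, h.2, hk]
  · rfl

lemma tildeG_eq (τ : ℂ) :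
    tildeG 1 1 τ = ∑' m : ℤ, (∑' n : ℤ, 1 / ((m : ℂ) + n * τ) ^ 2) ^ 2 := by
  unfold tildeG
  refine tsum_congr fun m => ?_
  rw [sq (∑' n : ℤ, 1 / ((m : ℂ) + n * τ) ^ 2), ← tsum_mul_right]
  refine tsum_congr fun n₁ => ?_
  rw [← tsum_mul_left]
  refine tsum_congr fun n₂ => ?_
  split_ifs with h
  · rcases h with h | h <;> simp [h.1, h.2]
  · rw [one_div_mul_one_div]

theorem tildeG_two_two (τ : ℂ) (hτ : 0 < τ.im) :
    tildeG 1 1 τ = G 4 τ + 2 * (π : ℂ) ^ 2 / (3 * τ ^ 2) * G 2 τ -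
      2 * (π : ℂ) ^ 4 / (15 * τ ^ 4) := by
  rw [tildeG_eq, G_eq 4 (by norm_num), G_eq 2 (by norm_num), tsum_congr (S_four τ hτ)]
  have hs := S_summable τ hτ
  set f : ℤ → ℂ := fun m => ∑' n : ℤ, 1 / ((m : ℂ) + n * τ) ^ 2 with hf
  have hs2 : Summable fun m => f m ^ 2 := by
    refine Summable.of_norm_bounded_eventually (g := fun m => ‖f m‖) hs.norm ?_
    have h1 : ∀ᶠ m in Filter.cofinite, ‖f m‖ < 1 := by
      have := hs.norm.tendsto_cofinite_zero
      exact this.eventually (gt_mem_nhds one_pos)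
    filter_upwards [h1] with m hm
    rw [norm_pow]
    exact pow_le_of_le_one (norm_nonneg _) hm.le two_ne_zero
  have hd : HasSum (fun m : ℤ => if m = 0 then 2 * (π : ℂ) ^ 4 / (15 * τ ^ 4) else 0)
      (2 * (π : ℂ) ^ 4 / (15 * τ ^ 4)) := hasSum_ite_eq 0 _
  have := ((hs2.hasSum.sub (hs.hasSum.mul_left (2 * (π : ℂ) ^ 2 / (3 * τ ^ 2)))).add hd).tsum_eq
  rw [this]
  ring
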